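/- arXiv:2104.00671 — 5 statements merged into one kernel-verified Lean document; each statement's English description precedes it below -/
import Mathlib

section
/- Let E be a real inner product space, let u, v ∈ E be nonzero vectors, let δ ∈ E with ‖δ‖ ≤ ε, and let S, c ∈ ℝ be such that ⟨u, v⟩ / (‖u‖·‖v‖) ≥ S. If ⟨δ, v⟩ / ‖v‖ > c + ε·√(2 − 2S), then ⟨δ, u⟩ / ‖u‖ > c. -/
open RealInnerProductSpace

/-- For nonzero `u, v`, `‖δ‖ ≤ ε`, and `S` a lower bound on the cosine
similarity of `u` and `v`: if `⟪δ, v⟫ / ‖v‖ > c + ε·√(2 − 2S)` then `⟪δ, u⟫ / ‖u‖ > c`. -/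
theorem normalized_inner_gt_of_cosine_similarity_ge
    {E : Type*} [NormedAddCommGroup E] [InnerProductSpace ℝ E]
    (u v δ : E) {ε S c : ℝ}
    (hu : u ≠ 0) (hv : v ≠ 0) (hδ : ‖δ‖ ≤ ε)
    (hS : S ≤ ⟪u, v⟫ / (‖u‖ * ‖v‖))
    (h : ⟪δ, v⟫ / ‖v‖ > c + ε * Real.sqrt (2 - 2 * S)) :
    ⟪δ, u⟫ / ‖u‖ > c := by
  have hu' : ‖u‖ ≠ 0 := norm_ne_zero_iff.mpr hu
  have hv' : ‖v‖ ≠ 0 := norm_ne_zero_iff.mpr hv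
  set w : E := ‖v‖⁻¹ • v - ‖u‖⁻¹ • u with hw
  have hsq : ‖w‖ ^ 2 = 2 - 2 * (⟪u, v⟫ / (‖u‖ * ‖v‖)) := by
    rw [hw, norm_sub_sq_real, norm_smul, norm_smul, real_inner_smul_left,
      real_inner_smul_right, norm_inv, norm_inv, norm_norm, norm_norm, real_inner_comm]
    field_simp
    ring
  have hwS : ‖w‖ ≤ Real.sqrt (2 - 2 * S) := by
    apply Real.le_sqrt_of_sq_le
    linarith
  have hin : ⟪δ, w⟫ = ⟪δ, v⟫ / ‖v‖ - ⟪δ, u⟫ / ‖u‖ := by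
    rw [hw, inner_sub_right, real_inner_smul_right, real_inner_smul_right]
    ring
  have h1 : ⟪δ, w⟫ ≤ ε * Real.sqrt (2 - 2 * S) :=
    (real_inner_le_norm δ w).trans
      (mul_le_mul hδ hwS (norm_nonneg _) ((norm_nonneg _).trans hδ))
  linarith
end

section
/- Let E be a real inner product space and let x, y ∈ E be unit vectors (‖x‖ = ‖y‖ = 1) with ⟨x, y⟩ < S for some real number S. Then for every δ ∈ E, min(⟨δ, x⟩, ⟨δ, y⟩) ≤ ‖δ‖·√((1 + S)/2). -/
open RealInnerProductSpace

/-- For unit vectors `x, y` with `⟪x, y⟫ < S`, every `δ` satisfies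
`min (⟪δ, x⟫) (⟪δ, y⟫) ≤ ‖δ‖·√((1 + S)/2)`. -/
theorem min_inner_le_of_inner_lt
    {E : Type*} [NormedAddCommGroup E] [InnerProductSpace ℝ E]
    (x y : E) {S : ℝ}
    (hx : ‖x‖ = 1) (hy : ‖y‖ = 1) (hS : ⟪x, y⟫ < S) :
    ∀ δ : E, min ⟪δ, x⟫ ⟪δ, y⟫ ≤ ‖δ‖ * Real.sqrt ((1 + S) / 2) := by
  intro δ
  have h1 : ⟪δ, x⟫ + ⟪δ, y⟫ ≤ ‖δ‖ * ‖x + y‖ := by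
    rw [← inner_add_right]
    exact real_inner_le_norm δ (x + y)
  have h2 : ‖x + y‖ / 2 ≤ Real.sqrt ((1 + S) / 2) := by
    apply Real.le_sqrt_of_sq_le
    have h := norm_add_sq_real x y
    rw [hx, hy] at h
    nlinarith
  have h3 := mul_le_mul_of_nonneg_left h2 (norm_nonneg δ)
  have h4 := min_le_left ⟪δ, x⟫ ⟪δ, y⟫
  have h5 := min_le_right ⟪δ, x⟫ ⟪δ, y⟫
  linarith
end

section
/- Let E be a real inner product space, let u, v ∈ E be nonzero vectors with cosine similarity ⟨u, v⟩ / (‖u‖·‖v‖) ≤ S for some real number S, and let δ ∈ E with ‖δ‖ ≤ ε. If a, b ∈ ℝ satisfy ⟨δ, u⟩ ≥ a·‖u‖ and ⟨δ, v⟩ ≥ b·‖v‖, then a ≤ ε·√((1 + S)/2) or b ≤ ε·√((1 + S)/2). -/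
open RealInnerProductSpace

/-- For nonzero `u, v` with cosine similarity at most `S` and `‖δ‖ ≤ ε`:
if `⟪δ, u⟫ ≥ a·‖u‖` and `⟪δ, v⟫ ≥ b·‖v‖`, then `a ≤ ε·√((1 + S)/2)` or
`b ≤ ε·√((1 + S)/2)`. -/
theorem le_sqrt_of_inner_ge_of_cosine_similarity_le
    {E : Type*} [NormedAddCommGroup E] [InnerProductSpace ℝ E]
    (u v δ : E) {ε S a b : ℝ}
    (hu : u ≠ 0) (hv : v ≠ 0)
    (hS : ⟪u, v⟫ / (‖u‖ * ‖v‖) ≤ S) (hδ : ‖δ‖ ≤ ε)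
    (ha : a * ‖u‖ ≤ ⟪δ, u⟫) (hb : b * ‖v‖ ≤ ⟪δ, v⟫) :
    a ≤ ε * Real.sqrt ((1 + S) / 2) ∨ b ≤ ε * Real.sqrt ((1 + S) / 2) := by
  have hu' : 0 < ‖u‖ := norm_pos_iff.mpr hu
  have hv' : 0 < ‖v‖ := norm_pos_iff.mpr hv
  have hε : 0 ≤ ε := (norm_nonneg δ).trans hδ
  obtain ⟨p, hp⟩ : ∃ p : E, p = ‖u‖⁻¹ • u := ⟨_, rfl⟩
  obtain ⟨q, hq⟩ : ∃ q : E, q = ‖v‖⁻¹ • v := ⟨_, rfl⟩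
  have hpn : ‖p‖ = 1 := by
    rw [hp, norm_smul, norm_inv, norm_norm, inv_mul_cancel₀ hu'.ne']
  have hqn : ‖q‖ = 1 := by
    rw [hq, norm_smul, norm_inv, norm_norm, inv_mul_cancel₀ hv'.ne']
  have hpq : ⟪p, q⟫ ≤ S := by
    refine le_trans (le_of_eq ?_) hS
    rw [hp, hq, real_inner_smul_left, real_inner_smul_right]
    field_simp
  have hap : a ≤ ⟪δ, p⟫ := by
    rw [hp, real_inner_smul_right, inv_mul_eq_div, le_div_iff₀ hu']
    exact ha
  have hbq : b ≤ ⟪δ, q⟫ := by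
    rw [hq, real_inner_smul_right, inv_mul_eq_div, le_div_iff₀ hv']
    exact hb
  have hsq : ‖p + q‖ ^ 2 = 2 + 2 * ⟪p, q⟫ := by
    rw [norm_add_sq_real, hpn, hqn]
    ring
  have hnorm : ‖p + q‖ / 2 ≤ Real.sqrt ((1 + S) / 2) := by
    apply Real.le_sqrt_of_sq_le
    rw [div_pow, hsq]
    linarith
  have hsum : a + b ≤ ε * ‖p + q‖ := by
    calc a + b ≤ ⟪δ, p + q⟫ := by rw [inner_add_right]; linarith
      _ ≤ ‖δ‖ * ‖p + q‖ := real_inner_le_norm _ _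
      _ ≤ ε * ‖p + q‖ := by gcongr
  have hfin := mul_le_mul_of_nonneg_left hnorm hε
  by_contra! h
  linarith [h.1, h.2]
end

section
/- Suppose Y is a two-element label set. Let δ, ρ, ε ∈ (0, 1). Suppose the attack A is ρ-conservative with respect to the marginal μ, the classifiers f and g each have risk at most ε, and A is (δ, f)-effective, i.e., Pr_{x∼μ}[f(x) ≠ f(A(x))] ≥ 1 − δ. Then A is (δ + 4ε + ρ, g)-effective, i.e., Pr_{x∼μ}[g(x) ≠ g(A(x))] ≥ 1 − (δ + 4ε + ρ). -/
open MeasureTheory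

/-- For a two-element label set, if the attack `A` is `ρ`-conservative with
respect to the marginal `μ` of `D`, the classifiers `f` and `g` each have risk at most
`ε`, and `A` is `(δ, f)`-effective, then `A` is `(δ + 4ε + ρ, g)`-effective. -/
theorem effective_transfer_of_conservative_of_low_risk_binary
    {X : Type*} [MeasurableSpace X]
    {Y : Type*} [Fintype Y] [MeasurableSpace Y] [MeasurableSingletonClass Y]
    (hY : Fintype.card Y = 2)
    (D : Measure (X × Y)) [IsProbabilityMeasure D]
    (f g : X → Y) (A : X → X)
    (hf : Measurable f) (hg : Measurable g) (hA : Measurable A)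
    {δ ρ ε : ℝ} (hδ0 : 0 < δ) (hδ1 : δ < 1) (hρ0 : 0 < ρ) (hρ1 : ρ < 1)
    (hε0 : 0 < ε) (hε1 : ε < 1)
    (hcons : ∀ C : Set X, MeasurableSet C →
      |((D.map Prod.fst) C).toReal - ((D.map Prod.fst) (A ⁻¹' C)).toReal| ≤ ρ)
    (hf_risk : (D {p : X × Y | f p.1 ≠ p.2}).toReal ≤ ε)
    (hg_risk : (D {p : X × Y | g p.1 ≠ p.2}).toReal ≤ ε)
    (heff : (1 : ℝ) - δ ≤ ((D.map Prod.fst) {x | f x ≠ f (A x)}).toReal) :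
    (1 : ℝ) - (δ + 4 * ε + ρ) ≤ ((D.map Prod.fst) {x | g x ≠ g (A x)}).toReal := by
  have hDis : MeasurableSet {x | f x ≠ g x} :=
    (hf.prodMk hg) (Set.toFinite {q : Y × Y | q.1 ≠ q.2}).measurableSet
  have : IsProbabilityMeasure (D.map Prod.fst) :=
    Measure.isProbabilityMeasure_map measurable_fst.aemeasurable
  have h1 : (D.map Prod.fst).real {x | f x ≠ g x} ≤ 2 * ε := by
    have e : (D.map Prod.fst).real {x | f x ≠ g x} = D.real (Prod.fst ⁻¹' {x | f x ≠ g x}) := by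
      simp only [Measure.real]
      rw [Measure.map_apply measurable_fst hDis]
    have hsub : (Prod.fst ⁻¹' {x | f x ≠ g x} : Set (X × Y)) ⊆
        {p : X × Y | f p.1 ≠ p.2} ∪ {p : X × Y | g p.1 ≠ p.2} := by
      rintro ⟨x, y⟩ h
      simp only [Set.mem_preimage, Set.mem_setOf_eq, Set.mem_union] at h ⊢
      by_contra! hc
      exact h (hc.1.trans hc.2.symm)
    have h2 := measureReal_mono (μ := D) hsub
    have h3 := measureReal_union_le (μ := D)
      {p : X × Y | f p.1 ≠ p.2} {p : X × Y | g p.1 ≠ p.2}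
    simp only [Measure.real] at *
    linarith
  have h2 := (abs_le.1 (hcons _ hDis)).1
  have hsub : {x | f x ≠ f (A x)} ⊆
      ({x | g x ≠ g (A x)} ∪ {x | f x ≠ g x}) ∪ A ⁻¹' {x | f x ≠ g x} := by
    intro x h
    simp only [Set.mem_preimage, Set.mem_setOf_eq, Set.mem_union] at h ⊢
    by_contra! hc
    exact h (hc.1.2.trans (hc.1.1.trans hc.2.symm))
  have h3 := measureReal_mono (μ := D.map Prod.fst) hsub
  have h4 := measureReal_union_le (μ := D.map Prod.fst)
    ({x | g x ≠ g (A x)} ∪ {x | f x ≠ g x}) (A ⁻¹' {x | f x ≠ g x})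
  have h5 := measureReal_union_le (μ := D.map Prod.fst)
    {x | g x ≠ g (A x)} {x | f x ≠ g x}
  simp only [Measure.real] at *
  linarith
end

section
/- Let (Ω, P) be a probability space and Z : Ω → ℝ a measurable random variable with |Z| ≤ ε almost surely, where ε ≥ 0. Suppose t ∈ ℝ and α ∈ [0, 1] satisfy P[Z > t] ≤ α. Then for every c ∈ ℝ with c + ε > 0, P[Z > c] ≤ (ε(1 + α) + t(1 − α)) / (c + ε). -/
open MeasureTheory

/-- Markov-type bound. If `|Z| ≤ ε` almost surely, `P[Z > t] ≤ α` with
`α ∈ [0, 1]`, then for every `c` with `c + ε > 0`,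
`P[Z > c] ≤ (ε(1 + α) + t(1 − α)) / (c + ε)`. -/
theorem prob_gt_le_of_abs_le_of_prob_gt_le
    {Ω : Type*} [MeasurableSpace Ω] (P : Measure Ω) [IsProbabilityMeasure P]
    (Z : Ω → ℝ) (hZmeas : Measurable Z)
    {ε : ℝ} (hε : 0 ≤ ε) (hZ : ∀ᵐ ω ∂P, |Z ω| ≤ ε)
    {t α : ℝ} (hα0 : 0 ≤ α) (hα1 : α ≤ 1)
    (ht : (P {ω | Z ω > t}).toReal ≤ α)
    (c : ℝ) (hc : 0 < c + ε) :
    (P {ω | Z ω > c}).toReal ≤ (ε * (1 + α) + t * (1 - α)) / (c + ε) := by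
  have hq0 : 0 ≤ (P {ω | Z ω > c}).toReal := ENNReal.toReal_nonneg
  have hq1 : (P {ω | Z ω > c}).toReal ≤ 1 := by
    have := measureReal_le_one (μ := P) (s := {ω | Z ω > c})
    simpa [Measure.real] using this
  -- the numerator is nonnegative
  have key : α = 1 ∨ -ε ≤ t := by
    by_cases h : -ε ≤ t
    · exact Or.inr h
    · left
      have h1 : P {ω | Z ω > t} = 1 := by
        rw [← measure_univ (μ := P)]
        apply measure_congr
        filter_upwards [hZ] with ω hω
        apply propext
        have := (abs_le.mp hω).1
        constructor
        · intro _; trivial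
        · intro _
          change t < Z ω
          linarith
      rw [h1] at ht
      simp at ht
      linarith
  have hnum : 0 ≤ ε * (1 + α) + t * (1 - α) := by
    rcases key with h | h
    · subst h; linarith
    · nlinarith [mul_nonneg hε hα0, mul_nonneg (by linarith : 0 ≤ t + ε) (by linarith : 0 ≤ 1 - α)]
  rw [le_div_iff₀ hc]
  rcases le_or_gt ε c with hce | hce
  · have h0 : P {ω | Z ω > c} = 0 := by
      have : ∀ᵐ ω ∂P, ¬ (Z ω > c) := by
        filter_upwards [hZ] with ω hω
        have := (abs_le.mp hω).2
        linarith
      simpa [ae_iff] using this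
    rw [h0]
    simpa using hnum
  rcases le_or_gt t c with htc | htc
  · have hqp : (P {ω | Z ω > c}).toReal ≤ α := by
      refine le_trans (ENNReal.toReal_mono (measure_ne_top _ _) (measure_mono ?_)) ht
      intro ω hω
      exact lt_of_le_of_lt htc hω
    have h1 : (P {ω | Z ω > c}).toReal * (c + ε) ≤ α * (2 * ε) :=
      mul_le_mul hqp (by linarith) hc.le hα0
    rcases key with h | h
    · subst h; linarith
    · nlinarith [mul_nonneg (by linarith : 0 ≤ t + ε) (by linarith : 0 ≤ 1 - α)]
  · have h1 : (P {ω | Z ω > c}).toReal * (c + ε) ≤ 1 * (c + ε) :=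
      mul_le_mul_of_nonneg_right hq1 hc.le
    nlinarith [mul_nonneg (by linarith : 0 ≤ t - c) (by linarith : 0 ≤ 1 - α),
      mul_nonneg (by linarith : 0 ≤ ε - c) hα0]
end
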